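/- arXiv:1010.0599 — 6 statements merged into one kernel-verified Lean document; each statement's English description precedes it below -/
import Mathlib

section
/- For every a ∈ Ẑ and every r ∈ ℕ, the set A(r,a) = {(m,k) ∈ ℕ⋊ℕ^× : a ∈ kẐ, m ≤ r and k divides r−m} is a nonempty hereditary directed subset of ℕ⋊ℕ^× (i.e., an element of the Nica spectrum Ω), and for every r ∈ Ẑ the set B(r,a) = {(m,k) ∈ ℕ⋊ℕ^× : a ∈ kẐ and r−m ∈ kẐ} is a nonempty hereditary directed subset of ℕ⋊ℕ^×. -/
open scoped Classical

instance (p : Nat.Primes) : Fact (Nat.Prime (p : ℕ)) := ⟨p.2⟩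

/-- `Ẑ = ∏_p ℤ_p`. -/
abbrev Zhat : Type := Π p : Nat.Primes, ℤ_[(p : ℕ)]

/-- Elements of the semigroup `ℕ ⋊ ℕ^×`. -/
abbrev NxN : Type := ℕ × ℕ+

/-- The semigroup operation `(m,k)(n,l) = (m + k n, k l)`. -/
def nmul (x y : NxN) : NxN := (x.1 + (x.2 : ℕ) * y.1, x.2 * y.2)

/-- `x ≤ y` iff `y ∈ x (ℕ ⋊ ℕ^×)`. -/
def nle (x y : NxN) : Prop := ∃ z : NxN, y = nmul x z

def Hereditary (ω : Set NxN) : Prop := ∀ x y : NxN, y ∈ ω → nle x y → x ∈ ω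

def DirectedSet (ω : Set NxN) : Prop := ∀ x ∈ ω, ∀ y ∈ ω, ∃ z ∈ ω, nle x z ∧ nle y z

/-- A nonempty hereditary directed subset of `ℕ ⋊ ℕ^×`. -/
def IsNica (ω : Set NxN) : Prop := ω.Nonempty ∧ Hereditary ω ∧ DirectedSet ω

/-- The Nica spectrum. -/
def Omega : Type := {ω : Set NxN // IsNica ω}

/-- `a ∈ kẐ`. -/
def inK (a : Zhat) (k : ℕ) : Prop := ∃ z : Zhat, a = (k : Zhat) * z

/-- The type A sets. -/
def Aset (r : ℕ) (a : Zhat) : Set NxN :=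
  {x | inK a (x.2 : ℕ) ∧ x.1 ≤ r ∧ (x.2 : ℕ) ∣ (r - x.1)}

/-- The type B sets. -/
def Bset (r : Zhat) (a : Zhat) : Set NxN :=
  {x | inK a (x.2 : ℕ) ∧ ∃ z : Zhat, r - (x.1 : Zhat) = ((x.2 : ℕ) : Zhat) * z}

/-- `N̄ = ℕ ⊔ Ẑ`. -/
abbrev NBar : Type := ℕ ⊕ Zhat

/-- The parametrization map, as a map into subsets of `ℕ ⋊ ℕ^×`. -/
def pset : NBar × Zhat → Set NxN
  | (Sum.inl r, a) => Aset r a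
  | (Sum.inr r, a) => Bset r a

/-- In a commutative ring, common multiples of two natural numbers are multiples of their lcm. -/
theorem natCast_lcm_dvd {R : Type*} [CommRing R] {k l : ℕ} {a : R}
    (hk : (k : R) ∣ a) (hl : (l : R) ∣ a) : ((k.lcm l : ℕ) : R) ∣ a := by
  rcases Nat.eq_zero_or_pos (k.gcd l) with h0 | hpos
  · obtain ⟨rfl, rfl⟩ := Nat.gcd_eq_zero_iff.mp h0
    simpa using hk
  obtain ⟨g, k', l', -, hcop, rfl, rfl⟩ := Nat.exists_coprime' hpos
  obtain ⟨s, hs⟩ := hk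
  obtain ⟨t, ht⟩ := hl
  have hlcm : (k' * g).lcm (l' * g) = k' * l' * g := by
    rw [Nat.lcm_mul_right, hcop.lcm_eq_mul]
  obtain ⟨u, v, huv⟩ := Nat.isCoprime_iff_coprime.mpr hcop
  have huv' : (u : R) * k' + v * l' = 1 := by exact_mod_cast congrArg (Int.cast : ℤ → R) huv
  rw [hlcm]
  refine ⟨u * t + v * s, ?_⟩
  push_cast at hs ht ⊢
  linear_combination (-a) * huv' + u * k' * ht + v * l' * hs

/-- Divisibility of integers by a natural number can be tested in `Ẑ`. -/
theorem Zhat.int_dvd_of_natCast_dvd {d : ℕ} {e : ℤ}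
    (h : (d : Zhat) ∣ (e : Zhat)) : (d : ℤ) ∣ e := by
  rw [Int.natCast_dvd]
  refine (Nat.dvd_iff_prime_pow_dvd_dvd _ _).mpr fun p n hp hpn => ?_
  have : Fact p.Prime := ⟨hp⟩
  obtain ⟨z, hz⟩ := h
  have hz' : (e : ℤ_[p]) = (d : ℤ_[p]) * z ⟨p, hp⟩ := congrFun hz ⟨p, hp⟩
  have hdvd : (p : ℤ_[p]) ^ n ∣ (e : ℤ_[p]) := by
    rw [hz']
    exact Dvd.dvd.mul_right (by exact_mod_cast Nat.cast_dvd_cast (α := ℤ_[p]) hpn) _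
  have : ((p ^ n : ℕ) : ℤ) ∣ e := by
    exact_mod_cast (PadicInt.pow_p_dvd_int_iff n e).mp hdvd
  exact Int.natCast_dvd.mp this

theorem inK_iff_dvd {a : Zhat} {k : ℕ} : inK a k ↔ (k : Zhat) ∣ a := Iff.rfl

theorem nle_of_dvd {x y : NxN} (h₁ : x.1 ≤ y.1) (hd : (x.2 : ℕ) ∣ y.1 - x.1)
    (h₂ : x.2 ∣ y.2) : nle x y := by
  obtain ⟨n, hn⟩ := hd
  obtain ⟨l, hl⟩ := h₂
  exact ⟨(n, l), Prod.ext (by simp only [nmul]; omega) hl⟩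

theorem Aset_isNica (r : ℕ) (a : Zhat) : IsNica (Aset r a) := by
  refine ⟨⟨(0, 1), ⟨a, by simp⟩, by simp, by simp⟩, ?_, ?_⟩
  · rintro ⟨m, k⟩ _ ⟨ha, hle, hdvd⟩ ⟨⟨n, l⟩, rfl⟩
    simp only [nmul, inK_iff_dvd, PNat.mul_coe, Nat.cast_mul] at ha hle hdvd
    refine ⟨(dvd_mul_right _ _).trans ha, (Nat.le_add_right _ _).trans hle, ?_⟩
    have h : r - m = (r - (m + k * n)) + k * n := by omega
    change (k : ℕ) ∣ r - m
    rw [h]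
    exact dvd_add ((dvd_mul_right _ _).trans hdvd) (dvd_mul_right _ _)
  · rintro ⟨m, k⟩ ⟨hak, hm, hk⟩ ⟨n, l⟩ ⟨hal, hn, hl⟩
    refine ⟨(r, k.lcm l), ⟨?_, le_rfl, by simp⟩, nle_of_dvd hm hk (PNat.dvd_lcm_left k l),
      nle_of_dvd hn hl (PNat.dvd_lcm_right k l)⟩
    rw [inK_iff_dvd, PNat.lcm_coe]
    exact natCast_lcm_dvd hak hal

theorem Bset_isNica (r a : Zhat) : IsNica (Bset r a) := by
  refine ⟨⟨(0, 1), ⟨a, by simp⟩, r, by simp⟩, ?_, ?_⟩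
  · rintro ⟨m, k⟩ _ ⟨ha, z, hz⟩ ⟨⟨n, l⟩, rfl⟩
    simp only [nmul, inK_iff_dvd, PNat.mul_coe, Nat.cast_mul, Nat.cast_add] at ha hz
    refine ⟨(dvd_mul_right _ _).trans ha, l * z + n, ?_⟩
    linear_combination hz
  · rintro ⟨m, k⟩ ⟨hak, hk⟩ ⟨n, l⟩ ⟨hal, hl⟩
    change ((k : ℕ) : Zhat) ∣ r - (m : Zhat) at hk
    change ((l : ℕ) : Zhat) ∣ r - (n : Zhat) at hl
    have hg : ((Nat.gcd k l : ℕ) : Zhat) ∣ ((n - m : ℤ) : Zhat) := by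
      have := dvd_sub ((Nat.cast_dvd_cast (Nat.gcd_dvd_left k l)).trans hk)
        ((Nat.cast_dvd_cast (Nat.gcd_dvd_right k l)).trans hl)
      push_cast
      convert this using 1
      ring
    have hmod : m ≡ n [MOD Nat.gcd k l] := Nat.modEq_iff_dvd.mpr
      (Zhat.int_dvd_of_natCast_dvd hg)
    obtain ⟨q₀, hq₀k, hq₀l⟩ := Nat.chineseRemainder' hmod
    obtain ⟨q, hmq, hnq, hqk, hql⟩ : ∃ q, m ≤ q ∧ n ≤ q ∧ m ≡ q [MOD k] ∧ n ≡ q [MOD l] := by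
      have hpos : 1 ≤ (k * l : ℕ) := (k * l).pos
      refine ⟨q₀ + k * l * (m + n), by nlinarith, by nlinarith, ?_, ?_⟩
      · refine hq₀k.symm.trans ((Nat.modEq_iff_dvd' (by omega)).mpr ?_)
        rw [Nat.add_sub_cancel_left, mul_assoc]
        exact dvd_mul_right _ _
      · refine hq₀l.symm.trans ((Nat.modEq_iff_dvd' (by omega)).mpr ?_)
        rw [Nat.add_sub_cancel_left, mul_comm (k : ℕ), mul_assoc]
        exact dvd_mul_right _ _
    replace hqk := (Nat.modEq_iff_dvd' hmq).mp hqk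
    replace hql := (Nat.modEq_iff_dvd' hnq).mp hql
    refine ⟨(q, k.lcm l), ⟨?_, ?_⟩, nle_of_dvd hmq hqk (PNat.dvd_lcm_left k l),
      nle_of_dvd hnq hql (PNat.dvd_lcm_right k l)⟩
    · rw [inK_iff_dvd, PNat.lcm_coe]
      exact natCast_lcm_dvd hak hal
    · change (((k.lcm l : ℕ+) : ℕ) : Zhat) ∣ r - (q : Zhat)
      rw [PNat.lcm_coe]
      apply natCast_lcm_dvd
      · have := dvd_sub hk (Nat.cast_dvd_cast (α := Zhat) hqk)
        rwa [Nat.cast_sub hmq, sub_sub, add_sub_cancel] at this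
      · have := dvd_sub hl (Nat.cast_dvd_cast (α := Zhat) hql)
        rwa [Nat.cast_sub hnq, sub_sub, add_sub_cancel] at this

/-- For every `a ∈ Ẑ`: each `A(r,a)` (`r ∈ ℕ`) and each `B(r,a)` (`r ∈ Ẑ`) is a nonempty
hereditary directed subset of `ℕ ⋊ ℕ^×`, i.e. an element of the Nica spectrum. -/
theorem Aset_Bset_isNica (a : Zhat) :
    (∀ r : ℕ, IsNica (Aset r a)) ∧ (∀ r : Zhat, IsNica (Bset r a)) := by
  exact ⟨fun r => Aset_isNica r a, fun r => Bset_isNica r a⟩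
end

section
/- The map p : N̄ × Ẑ → Ω, defined by p(r,a) = A(r,a) for r ∈ ℕ and p(r,a) = B(r,a) for r ∈ Ẑ, is continuous, where N̄ × Ẑ carries the product topology and Ω carries the topology of pointwise convergence of characteristic functions. -/
open scoped Classical

/-- Basic open sets of the compactification `N̄ = ℕ ⊔ Ẑ`: singletons `{n}`, `n ∈ ℕ`, and the
sets `{n ∈ ℕ : n ≥ n₀, γ(n) ∈ U} ⊔ U` for `n₀ ∈ ℕ` and `U ⊆ Ẑ` open. -/
def nbarBasis : Set (Set NBar) :=
  {S | (∃ n : ℕ, S = {Sum.inl n}) ∨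
    ∃ (n₀ : ℕ) (U : Set Zhat), IsOpen U ∧
      S = Sum.inl '' {n : ℕ | n₀ ≤ n ∧ ((n : Zhat) ∈ U)} ∪ Sum.inr '' U}

/-- The topology of `N̄`. -/
instance nbarTopology : TopologicalSpace NBar := TopologicalSpace.generateFrom nbarBasis

/-- The characteristic function of a subset of `ℕ ⋊ ℕ^×`. -/
noncomputable def charfun (ω : Set NxN) : NxN → Bool := fun x => decide (x ∈ ω)

/-- The topology of pointwise convergence of characteristic functions on subsets of
`ℕ ⋊ ℕ^×` (the topology of `Ω` and of its ambient space `{0,1}^{ℕ⋊ℕ^×}`). -/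
noncomputable instance setNxNTopology : TopologicalSpace (Set NxN) :=
  TopologicalSpace.induced charfun Pi.topologicalSpace

theorem PadicInt.dvd_of_norm_le {p : ℕ} [Fact p.Prime] {x y : ℤ_[p]} (h : ‖x‖ ≤ ‖y‖) :
    y ∣ x := by
  by_cases hy : y = 0
  · subst hy
    rw [norm_zero, norm_le_zero_iff] at h
    rw [h]
  · have hy' : (y : ℚ_[p]) ≠ 0 := fun h0 => hy (PadicInt.ext h0)
    refine ⟨⟨(x : ℚ_[p]) / y, ?_⟩, PadicInt.ext ?_⟩
    · rw [norm_div]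
      exact div_le_one_of_le₀ h (norm_nonneg _)
    · exact (mul_div_cancel₀ _ hy').symm

theorem inK_iff_norm_le (a : Zhat) (k : ℕ) :
    inK a k ↔ ∀ p : Nat.Primes, ‖a p‖ ≤ ‖(k : ℤ_[(p : ℕ)])‖ := by
  constructor
  · rintro ⟨z, rfl⟩ p
    rw [Pi.mul_apply, Pi.natCast_apply, norm_mul]
    exact mul_le_of_le_one_right (norm_nonneg _) (PadicInt.norm_le_one _)
  · intro h
    have hdvd : ∀ p : Nat.Primes, ∃ z : ℤ_[(p : ℕ)], a p = (k : ℤ_[(p : ℕ)]) * z :=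
      fun p => PadicInt.dvd_of_norm_le (h p)
    choose z hz using hdvd
    exact ⟨z, funext hz⟩

theorem inK_natCast_iff (d k : ℕ) : inK (d : Zhat) k ↔ k ∣ d := by
  constructor
  · intro h
    rw [inK_iff_norm_le] at h
    rw [Nat.dvd_iff_prime_pow_dvd_dvd]
    intro p v hp hk
    have : Fact p.Prime := ⟨hp⟩
    have key : ∀ n : ℕ, ‖(n : ℤ_[p])‖ ≤ (p : ℝ) ^ (-v : ℤ) ↔ p ^ v ∣ n := fun n => by
      have := PadicInt.norm_int_le_pow_iff_dvd (p := p) (k := n) (n := v)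
      exact_mod_cast this
    exact (key d).1 ((h ⟨p, hp⟩).trans ((key k).2 hk))
  · rintro ⟨c, rfl⟩
    exact ⟨(c : Zhat), Nat.cast_mul k c⟩

theorem isClopen_setOf_inK {k : ℕ} (hk : k ≠ 0) : IsClopen {a : Zhat | inK a k} := by
  have hpi : {a : Zhat | inK a k} = Set.pi {p : Nat.Primes | (p : ℕ) ∣ k}
      fun p => Metric.closedBall (0 : ℤ_[(p : ℕ)]) ‖(k : ℤ_[(p : ℕ)])‖ := by
    ext a
    simp only [Set.mem_ofPred_eq, inK_iff_norm_le, Set.mem_pi, mem_closedBall_zero_iff]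
    refine ⟨fun h p _ => h p, fun h p => ?_⟩
    by_cases hp : (p : ℕ) ∣ k
    · exact h p hp
    · have h1 : ‖(k : ℤ_[(p : ℕ)])‖ = 1 :=
        PadicInt.norm_natCast_eq_one_iff.2 ((Nat.Prime.coprime_iff_not_dvd p.2).2 hp)
      rw [h1]
      exact PadicInt.norm_le_one _
  have hfin : {p : Nat.Primes | (p : ℕ) ∣ k}.Finite :=
    ((Set.finite_Iic k).preimage Subtype.val_injective.injOn).subset
      fun _ hp => Nat.le_of_dvd (Nat.pos_of_ne_zero hk) hp
  rw [hpi]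
  refine ⟨isClosed_set_pi fun p _ => Metric.isClosed_closedBall,
    isOpen_set_pi hfin fun p hp => IsUltrametricDist.isOpen_closedBall _ ?_⟩
  have hk0 : (k : ℤ_[(p : ℕ)]) ≠ 0 := Nat.cast_ne_zero.2 hk
  exact norm_ne_zero_iff.2 hk0

theorem isClopen_setOf_inK_sub (m : ℕ) {k : ℕ} (hk : k ≠ 0) :
    IsClopen {r : Zhat | inK (r - (m : Zhat)) k} :=
  (isClopen_setOf_inK hk).preimage (continuous_id.sub continuous_const)

theorem NBar.isOpen_tail (n₀ : ℕ) {U : Set Zhat} (hU : IsOpen U) :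
    IsOpen (Sum.inl '' {n : ℕ | n₀ ≤ n ∧ (n : Zhat) ∈ U} ∪ Sum.inr '' U : Set NBar) :=
  TopologicalSpace.isOpen_generateFrom_of_mem (Or.inr ⟨n₀, U, hU, rfl⟩)

theorem NBar.isOpen_image_inl (s : Set ℕ) : IsOpen (Sum.inl '' s : Set NBar) := by
  rw [← Set.biUnion_of_singleton s, Set.image_iUnion₂]
  refine isOpen_biUnion fun n _ => ?_
  rw [Set.image_singleton]
  exact TopologicalSpace.isOpen_generateFrom_of_mem (Or.inl ⟨n, rfl⟩)

theorem NBar.isClopen_tail (n₀ : ℕ) {U : Set Zhat} (hU : IsClopen U) :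
    IsClopen (Sum.inl '' {n : ℕ | n₀ ≤ n ∧ (n : Zhat) ∈ U} ∪ Sum.inr '' U : Set NBar) := by
  refine ⟨⟨?_⟩, NBar.isOpen_tail n₀ hU.isOpen⟩
  convert (NBar.isOpen_image_inl (Set.Iio n₀)).union
    (NBar.isOpen_tail n₀ hU.compl.isOpen) using 1
  ext (n | r)
  · by_cases hn : n₀ ≤ n
    · simp [hn]
    · simp [hn, not_le.1 hn]
  · simp

theorem setOf_mem_pset (m : ℕ) (k : ℕ+) :
    {q : NBar × Zhat | (m, k) ∈ pset q} =
      (Sum.inl '' {n : ℕ | m ≤ n ∧ (n : Zhat) ∈ {r : Zhat | inK (r - (m : Zhat)) k}} ∪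
        Sum.inr '' {r : Zhat | inK (r - (m : Zhat)) k}) ×ˢ {a : Zhat | inK a k} := by
  ext ⟨n | r, a⟩
  · have hdvd : m ≤ n → (inK ((n : Zhat) - (m : Zhat)) k ↔ (k : ℕ) ∣ n - m) := fun h => by
      rw [← Nat.cast_sub h, inK_natCast_iff]
    simp only [pset, Aset, Set.mem_ofPred_eq, Set.mem_prod, Set.mem_union, Set.mem_image,
      Sum.inl.injEq, exists_eq_right, reduceCtorEq, and_false, exists_false, or_false]
    rw [and_comm, and_congr_right hdvd]
  · simp only [pset, Bset, Set.mem_ofPred_eq, Set.mem_prod, Set.mem_union, Set.mem_image,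
      Sum.inr.injEq, exists_eq_right, reduceCtorEq, and_false, exists_false, false_or]
    exact and_comm

theorem isClopen_setOf_mem_pset (x : NxN) : IsClopen {q : NBar × Zhat | x ∈ pset q} := by
  obtain ⟨m, k⟩ := x
  rw [setOf_mem_pset]
  exact (NBar.isClopen_tail m (isClopen_setOf_inK_sub m k.ne_zero)).prod
    (isClopen_setOf_inK k.ne_zero)

/-- The map `p : N̄ × Ẑ → Ω` is continuous. -/
theorem pset_continuous : Continuous pset := by
  refine continuous_induced_rng.2 (continuous_pi fun x => ?_)
  refine (continuous_bool_rng true).2 ?_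
  convert isClopen_setOf_mem_pset x using 1
  ext q
  simp [charfun]
end

section
/- For every (r,a) ∈ N̄ × Ẑ one can recover the coordinates of (r,a) from p(r,a) as follows: (i) aẐ = ⋂_{(n,l) ∈ p(r,a)} lẐ (intersection in Ẑ over all elements (n,l) of p(r,a)); (ii) if r ∈ ℕ then max{n ∈ ℕ : (n,l) ∈ p(r,a) for some l} = r, while if r ∈ Ẑ then the set {n ∈ ℕ : (n,l) ∈ p(r,a) for some l} is unbounded. -/
open scoped Classical

/-- Away from `p`, powers of `p` are invertible, so divisibility by `p ^ m` in `Ẑ` can be tested at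
the coordinate `p`. -/
theorem natCast_prime_pow_dvd_iff (p : Nat.Primes) (m : ℕ) (x : Zhat) :
    (((p : ℕ) ^ m : ℕ) : Zhat) ∣ x ↔ ((p : ℕ) : ℤ_[(p : ℕ)]) ^ m ∣ x p := by
  rw [pi_dvd_iff]
  refine ⟨fun h => by simpa using h p, fun h q => ?_⟩
  by_cases hq : q = p
  · subst hq
    simpa using h
  · refine IsUnit.dvd ?_
    have hcop : Nat.Coprime (q : ℕ) p :=
      (Nat.coprime_primes q.2 p.2).2 fun h => hq (Subtype.ext h)
    simpa using (PadicInt.isUnit_iff.2 (PadicInt.norm_natCast_eq_one_iff.2 hcop)).pow m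

theorem PadicInt.dvd_of_forall_prime_pow_dvd {p : ℕ} [Fact p.Prime] {a x : ℤ_[p]}
    (h : ∀ m : ℕ, (p : ℤ_[p]) ^ m ∣ a → (p : ℤ_[p]) ^ m ∣ x) : a ∣ x := by
  by_cases ha : a = 0
  · subst ha
    have hx : x = 0 := by
      by_contra hx
      have hdvd := h (x.valuation + 1) (dvd_zero _)
      rw [← Ideal.mem_span_singleton, PadicInt.mem_span_pow_iff_le_valuation x hx] at hdvd
      omega
    rw [hx]
  · have hassoc : Associated a ((p : ℤ_[p]) ^ a.valuation) := by
      conv_lhs => rw [PadicInt.unitCoeff_spec ha]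
      exact associated_unit_mul_left _ _ (Units.isUnit _)
    exact hassoc.dvd.trans (h _ hassoc.symm.dvd)

theorem exists_mem_pset_of_prime_pow_dvd (r : NBar) (a : Zhat) (p : Nat.Primes) (m : ℕ)
    (h : ((p : ℕ) : ℤ_[(p : ℕ)]) ^ m ∣ a p) :
    ∃ n : ℕ, ((n, ⟨(p : ℕ) ^ m, pow_pos p.2.pos m⟩) : NxN) ∈ pset (r, a) := by
  have ha : inK a ((p : ℕ) ^ m) := (natCast_prime_pow_dvd_iff p m a).2 h
  cases r with
  | inl r => exact ⟨r, ha, le_rfl, by simp⟩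
  | inr r =>
    refine ⟨(r p).appr m, ha, (natCast_prime_pow_dvd_iff p m _).2 ?_⟩
    simpa [Ideal.mem_span_singleton] using PadicInt.appr_spec m (r p)

/-- Recovering the coordinates of `(r,a) ∈ N̄ × Ẑ` from `p(r,a)`:
(i) `aẐ = ⋂_{(n,l) ∈ p(r,a)} lẐ`;
(ii) if `r ∈ ℕ` then `max {n : (n,l) ∈ p(r,a) for some l} = r`, while if `r ∈ Ẑ` then
`{n : (n,l) ∈ p(r,a) for some l}` is unbounded. -/
theorem coordinates_from_pset (a : Zhat) :
    (∀ r : NBar, {x : Zhat | ∃ z : Zhat, x = a * z} =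
        ⋂ y ∈ pset (r, a), {x : Zhat | ∃ z : Zhat, x = ((y.2 : ℕ) : Zhat) * z}) ∧
    (∀ r : ℕ, IsGreatest {n : ℕ | ∃ l : ℕ+, ((n, l) : NxN) ∈ pset (Sum.inl r, a)} r) ∧
    (∀ r : Zhat, ∀ N : ℕ, ∃ n : ℕ, N ≤ n ∧ ∃ l : ℕ+, ((n, l) : NxN) ∈ pset (Sum.inr r, a)) := by
  refine ⟨fun r => Set.Subset.antisymm ?_ ?_, fun r => ⟨⟨1, ?_⟩, ?_⟩, fun r N => ⟨N, le_rfl, 1, ?_⟩⟩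
  · rintro _ ⟨z, rfl⟩
    refine Set.mem_iInter₂.2 fun y hy => ?_
    have hya : inK a (y.2 : ℕ) := by
      cases r <;> exact hy.1
    obtain ⟨w, hw⟩ := hya
    exact ⟨w * z, by rw [hw, mul_assoc]⟩
  · intro x hx
    refine (pi_dvd_iff (x := a) (y := x)).2 fun p =>
      PadicInt.dvd_of_forall_prime_pow_dvd fun m hm => ?_
    obtain ⟨n, hn⟩ := exists_mem_pset_of_prime_pow_dvd r a p m hm
    exact (natCast_prime_pow_dvd_iff p m x).1 (Set.mem_iInter₂.1 hx _ hn)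
  · exact ⟨⟨a, by simp⟩, le_rfl, by simp⟩
  · rintro n ⟨l, hl⟩
    exact hl.2.1
  · exact ⟨⟨a, by simp⟩, r - N, by simp⟩
end

section
/- For every n ∈ ℕ^×, the pushforward map λ ↦ (y ↦ n·y)_*λ is a bijection from the set of finite Borel measures on the circle ℝ/ℤ that are invariant under translation by 1/n onto the set of all finite Borel measures on ℝ/ℤ. -/
open MeasureTheory

/-- The sum of an `n`-periodic sequence over a period does not depend on the starting point. -/
theorem sum_range_add_of_periodic {M : Type*} [AddCommMonoid M] {n : ℕ} {g : ℕ → M}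
    (hg : Function.Periodic g n) (j : ℕ) :
    ∑ k ∈ Finset.range n, g (k + j) = ∑ k ∈ Finset.range n, g k := by
  induction j with
  | zero => rfl
  | succ j ih =>
    rw [← ih]
    cases n with
    | zero => rfl
    | succ m =>
      rw [Finset.sum_range_succ, Finset.sum_range_succ']
      have h : g (m + (j + 1)) = g (0 + j) := by
        rw [← hg (0 + j)]
        congr 1
        ring
      rw [h]
      congr 1
      refine Finset.sum_congr rfl fun k _ => ?_
      congr 1
      ring

/-- Invariance under a translation, expressed through images, as a pushforward equation. -/
theorem forall_measure_image_add_right_iff {G : Type*} [AddGroup G] [MeasurableSpace G]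
    [MeasurableAdd G] (ν : Measure G) (a : G) :
    (∀ Y : Set G, MeasurableSet Y → ν ((fun y => y + a) '' Y) = ν Y) ↔
      ν.map (fun y => y + a) = ν := by
  have hT : Measurable fun y : G => y + a := measurable_add_const a
  constructor
  · intro h
    ext Y hY
    rw [Measure.map_apply hT hY, ← h _ (hT hY),
      Set.image_preimage_eq _ (add_right_surjective a)]
  · intro h Y hY
    have hY' : MeasurableSet ((fun y => y + a) '' Y) := by
      rw [Set.image_add_right]
      exact measurable_add_const (-a) hY
    conv_lhs => rw [← h]
    rw [Measure.map_apply hT hY', Set.preimage_image_eq _ (add_left_injective a)]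

section

variable {G : Type*} [AddCommGroup G] [MeasurableSpace G]

/-- The average, over the translates by multiples of `a`, of the pushforward of `μ` along `σ`. -/
noncomputable def averagedPushforward (n : ℕ) (a : G) (σ : G → G) (μ : Measure G) : Measure G :=
  (n : ENNReal)⁻¹ • ∑ k ∈ Finset.range n, μ.map (fun y => σ y + k • a)

variable {n : ℕ} {a : G} {σ : G → G}

theorem isFiniteMeasure_averagedPushforward (hn : 0 < n) (μ : Measure G) [IsFiniteMeasure μ] :
    IsFiniteMeasure (averagedPushforward n a σ μ) :=
  Measure.smul_finite _ (ENNReal.inv_ne_top.2 (by exact_mod_cast hn.ne'))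

variable [MeasurableAdd G]

theorem map_add_right_averagedPushforward (ha : n • a = 0) (hσ : Measurable σ)
    (μ : Measure G) :
    (averagedPushforward n a σ μ).map (fun y => y + a) = averagedPushforward n a σ μ := by
  have hT : Measurable fun y : G => y + a := measurable_add_const a
  have hg : Function.Periodic (fun k : ℕ => μ.map (fun y => σ y + k • a)) n := by
    intro k
    simp only [add_nsmul, ha, add_zero]
  rw [averagedPushforward, Measure.map_smul, Measure.map_finset_sum hT.aemeasurable,
    ← sum_range_add_of_periodic hg 1]
  congr 1
  refine Finset.sum_congr rfl fun k _ => ?_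
  rw [Measure.map_map hT (hσ.add_const _)]
  congr 1
  ext y
  simp [add_nsmul, add_assoc]

theorem map_nsmul_averagedPushforward (hn : 0 < n) (ha : n • a = 0) (hσ : Measurable σ)
    (hφ : Measurable fun y : G => n • y) (h : ∀ y, n • σ y = y) (μ : Measure G) :
    (averagedPushforward n a σ μ).map (fun y => n • y) = μ := by
  have hk : ∀ k ∈ Finset.range n,
      (μ.map (fun y => σ y + k • a)).map (fun y => n • y) = μ := by
    intro k _
    rw [Measure.map_map hφ (hσ.add_const _)]
    convert Measure.map_id using 2
    ext y
    simp [h, smul_comm n k, ha]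
  rw [averagedPushforward, Measure.map_smul, Measure.map_finset_sum hφ.aemeasurable,
    Finset.sum_congr rfl hk, Finset.sum_const, Finset.card_range,
    ← Nat.cast_smul_eq_nsmul ENNReal, smul_smul, ENNReal.inv_mul_cancel
      (by exact_mod_cast hn.ne') (ENNReal.natCast_ne_top n), one_smul]

/-- A measure invariant under translation by `a` is recovered from its pushforward under
multiplication by `n`, when the `n`-torsion consists of the multiples of `a`. -/
theorem averagedPushforward_map_nsmul (hn : 0 < n) (ha : n • a = 0) (hσ : Measurable σ)
    (hφ : Measurable fun y : G => n • y) (h : ∀ y, n • σ y = y)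
    (hker : ∀ u : G, n • u = 0 → ∃ j : ℕ, u = j • a) {ν : Measure G}
    (hν : ν.map (fun y => y + a) = ν) :
    averagedPushforward n a σ (ν.map (fun y => n • y)) = ν := by
  have hνk (k : ℕ) : ν.map (fun y => y + k • a) = ν := by
    induction k with
    | zero => simp
    | succ k ih =>
      conv_rhs => rw [← hν, ← ih, Measure.map_map (measurable_add_const _)
        (measurable_add_const _)]
      congr 1
      ext y
      simp [add_nsmul, add_assoc]
  ext Y hY
  have hT (k : ℕ) : Measurable fun y : G => y + k • a := measurable_add_const _
  have hS (k : ℕ) : Measurable fun y : G => σ (n • y) + k • a := (hσ.comp hφ).add_const _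
  have hpt (y : G) :
      ∑ k ∈ Finset.range n, ((fun y => σ (n • y) + k • a) ⁻¹' Y).indicator (1 : G → ENNReal) y =
        ∑ k ∈ Finset.range n, ((fun y => y + k • a) ⁻¹' Y).indicator (1 : G → ENNReal) y := by
    obtain ⟨j, hj⟩ := hker (σ (n • y) - y) (by rw [nsmul_sub, h, sub_self])
    have hg : Function.Periodic
        (fun k : ℕ => ((fun y => y + k • a) ⁻¹' Y).indicator (1 : G → ENNReal) y) n := by
      intro k
      simp only [add_nsmul, ha, add_zero]
    rw [← sum_range_add_of_periodic hg j]
    refine Finset.sum_congr rfl fun k _ => ?_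
    have : σ (n • y) + k • a = y + (k + j) • a := by
      rw [sub_eq_iff_eq_add.1 hj, add_nsmul]
      abel
    classical simp only [Set.indicator_apply, Set.mem_preimage, this]
  have hsum : ∑ k ∈ Finset.range n, ν ((fun y => σ (n • y) + k • a) ⁻¹' Y) =
      ∑ k ∈ Finset.range n, ν ((fun y => y + k • a) ⁻¹' Y) := by
    simp_rw [← fun k => lintegral_indicator_one (μ := ν) (hS k hY),
      ← fun k => lintegral_indicator_one (μ := ν) (hT k hY)]
    rw [← lintegral_finsetSum _ fun k _ => measurable_one.indicator (hS k hY),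
      ← lintegral_finsetSum _ fun k _ => measurable_one.indicator (hT k hY)]
    exact lintegral_congr hpt
  have hl (k : ℕ) : (ν.map (fun y => n • y)).map (fun y => σ y + k • a) Y =
      ν ((fun y => σ (n • y) + k • a) ⁻¹' Y) := by
    rw [Measure.map_map (hσ.add_const _) hφ, Measure.map_apply ((hσ.add_const _).comp hφ) hY]
    rfl
  have hr (k : ℕ) : ν ((fun y => y + k • a) ⁻¹' Y) = ν Y := by
    rw [← Measure.map_apply (hT k) hY, hνk]
  simp only [averagedPushforward, Measure.smul_apply, Measure.finsetSum_apply, hl, hsum, hr,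
    Finset.sum_const, Finset.card_range, nsmul_eq_mul, smul_eq_mul]
  rw [← mul_assoc, ENNReal.inv_mul_cancel (by exact_mod_cast hn.ne')
    (ENNReal.natCast_ne_top n), one_mul]

end

/-- Multiplication by `n` on the circle has a measurable right inverse. -/
theorem AddCircle.exists_measurable_nsmul_rightInverse {n : ℕ} (hn : 0 < n) :
    ∃ σ : AddCircle (1 : ℝ) → AddCircle (1 : ℝ), Measurable σ ∧ ∀ y, n • σ y = y := by
  refine ⟨fun y => (((AddCircle.measurableEquivIco (1 : ℝ) 0 y : ℝ) / n : ℝ) :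
    AddCircle (1 : ℝ)), ?_, fun y => ?_⟩
  · exact AddCircle.measurable_mk'.comp ((measurable_subtype_coe.comp
      (AddCircle.measurableEquivIco (1 : ℝ) 0).measurable).div_const _)
  · rw [← AddCircle.coe_nsmul, nsmul_eq_mul, mul_div_cancel₀ _ (by exact_mod_cast hn.ne')]
    exact (AddCircle.measurableEquivIco (1 : ℝ) 0).symm_apply_apply y

/-- For every `n ∈ ℕ^×`, the pushforward `λ ↦ (y ↦ n·y)_* λ` is a bijection from the set of
finite Borel measures on `ℝ/ℤ` invariant under translation by `1/n` onto the set of all finite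
Borel measures on `ℝ/ℤ`. -/
theorem pushforward_bijective (n : ℕ) (hn : 0 < n) :
    Set.BijOn (fun lam : Measure (AddCircle (1 : ℝ)) => lam.map (fun y => n • y))
      {lam | IsFiniteMeasure lam ∧ ∀ Y : Set (AddCircle (1 : ℝ)), MeasurableSet Y →
        lam ((fun y => y + (((n : ℝ)⁻¹ : ℝ) : AddCircle (1 : ℝ))) '' Y) = lam Y}
      {lam | IsFiniteMeasure lam} := by
  obtain ⟨σ, hσ, h⟩ := AddCircle.exists_measurable_nsmul_rightInverse hn
  have hn' : (n : ℝ) ≠ 0 := by exact_mod_cast hn.ne'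
  set a : AddCircle (1 : ℝ) := (((n : ℝ)⁻¹ : ℝ) : AddCircle (1 : ℝ)) with ha_def
  have ha : n • a = 0 := by
    rw [ha_def, ← AddCircle.coe_nsmul, nsmul_eq_mul, mul_inv_cancel₀ hn', AddCircle.coe_period]
  have hφ : Measurable fun y : AddCircle (1 : ℝ) => n • y := (continuous_nsmul n).measurable
  have hker (u : AddCircle (1 : ℝ)) (hu : n • u = 0) : ∃ j : ℕ, u = j • a := by
    obtain ⟨j, -, hj⟩ := (AddCircle.nsmul_eq_zero_iff hn).1 hu
    refine ⟨j, ?_⟩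
    rw [← hj, ha_def, ← AddCircle.coe_nsmul, nsmul_eq_mul, mul_one, div_eq_mul_inv]
  simp only [forall_measure_image_add_right_iff]
  refine Set.InvOn.bijOn (f' := averagedPushforward n a σ)
    ⟨fun ν hν => averagedPushforward_map_nsmul hn ha hσ hφ h hker hν.2,
      fun μ _ => map_nsmul_averagedPushforward hn ha hσ hφ h μ⟩ ?_ ?_
  · rintro ν ⟨_, -⟩
    exact Measure.isFiniteMeasure_map ν _
  · intro μ hμ
    have : IsFiniteMeasure μ := hμ
    exact ⟨isFiniteMeasure_averagedPushforward hn μ, map_add_right_averagedPushforward ha hσ μ⟩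
end

section
/- Let β ∈ ℝ and let λ₁ be a finite Borel measure on ℝ/ℤ. Then there exists a unique family (λ_m)_{m ∈ ℕ^×} of finite Borel measures on ℝ/ℤ such that λ_1 = λ₁, each λ_m is invariant under translation by 1/m, and λ_m = n^{β−1}·((y ↦ n·y)_*λ_{nm}) for all m, n ∈ ℕ^×. -/
open MeasureTheory

namespace AddCircle

/-- A section of multiplication by `m` on `ℝ/ℤ`: divide the representative in `[0, 1)` by `m`. -/
noncomputable def divNat (m : ℕ) (y : AddCircle (1 : ℝ)) : AddCircle (1 : ℝ) :=
  (((equivIco (1 : ℝ) 0 y : ℝ) / m : ℝ) : AddCircle (1 : ℝ))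

lemma measurable_divNat (m : ℕ) : Measurable (divNat m) := by
  unfold divNat
  have h : Measurable (equivIco (1 : ℝ) 0) := (measurableEquivIco (1 : ℝ) 0).measurable
  exact AddCircle.measurable_mk'.comp (h.subtype_val.div_const _)

lemma nsmul_divNat {m : ℕ} (hm : m ≠ 0) (y : AddCircle (1 : ℝ)) : m • divNat m y = y := by
  have hm' : (m : ℝ) ≠ 0 := Nat.cast_ne_zero.mpr hm
  rw [divNat, ← coe_nsmul, nsmul_eq_mul, mul_div_cancel₀ _ hm']
  exact (equivIco (1 : ℝ) 0).symm_apply_apply y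

lemma nsmul_coe_inv {m : ℕ} (hm : m ≠ 0) : m • (((m : ℝ)⁻¹ : ℝ) : AddCircle (1 : ℝ)) = 0 := by
  have hm' : (m : ℝ) ≠ 0 := Nat.cast_ne_zero.mpr hm
  rw [← coe_nsmul, nsmul_eq_mul, mul_inv_cancel₀ hm', coe_period]

lemma exists_zsmul_coe_inv_of_nsmul_eq_zero {m : ℕ} (hm : m ≠ 0) {u : AddCircle (1 : ℝ)}
    (hu : m • u = 0) : ∃ z : ℤ, u = z • (((m : ℝ)⁻¹ : ℝ) : AddCircle (1 : ℝ)) := by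
  have hm' : (m : ℝ) ≠ 0 := Nat.cast_ne_zero.mpr hm
  induction u using QuotientAddGroup.induction_on with
  | H r =>
    obtain ⟨z, hz⟩ := (coe_eq_zero_iff (1 : ℝ)).mp ((coe_nsmul (p := (1 : ℝ))).trans hu)
    refine ⟨z, ?_⟩
    rw [← coe_zsmul]
    congr 1
    simp only [zsmul_eq_mul, nsmul_eq_mul, mul_one] at hz ⊢
    rw [hz]
    field_simp

end AddCircle

lemma Finset.sum_range_nsmul_succ {G M : Type*} [AddMonoid G] [AddCommMonoid M] {m : ℕ} {c : G}
    (hc : m • c = 0) (g : G → M) :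
    ∑ k ∈ Finset.range m, g ((k + 1) • c) = ∑ k ∈ Finset.range m, g (k • c) := by
  cases m with
  | zero => simp
  | succ n =>
    rw [Finset.sum_range_succ, Finset.sum_range_succ' (fun k => g (k • c)), hc, zero_nsmul]

namespace MeasureTheory.Measure

open AddCircle

lemma forall_measure_image_add_right_iff (ν : Measure (AddCircle (1 : ℝ)))
    (c : AddCircle (1 : ℝ)) :
    (∀ Y, MeasurableSet Y → ν ((fun y => y + c) '' Y) = ν Y) ↔ ν.map (· + c) = ν := by
  have hadd : Measurable (fun y : AddCircle (1 : ℝ) => y + c) := measurable_add_const c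
  constructor
  · intro h
    ext Y hY
    rw [map_apply hadd hY, ← h _ (hadd hY),
      Set.image_preimage_eq (f := fun y => y + c) _ (fun y => ⟨y - c, sub_add_cancel y c⟩)]
  · intro h Y hY
    have hY' : MeasurableSet ((fun y => y + c) '' Y) := by
      rw [Set.image_add_right]
      exact measurable_add_const (-c) hY
    conv_lhs => rw [← h]
    rw [map_apply hadd hY', Set.preimage_image_eq _ (add_left_injective c)]

lemma map_add_nsmul_eq {ν : Measure (AddCircle (1 : ℝ))} {c : AddCircle (1 : ℝ)}
    (h : ν.map (· + c) = ν) (k : ℕ) : ν.map (· + k • c) = ν := by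
  induction k with
  | zero => simp
  | succ k ih =>
    conv_rhs => rw [← h, ← ih, map_map (measurable_add_const _) (measurable_add_const _)]
    congr 1
    ext y
    simp [succ_nsmul, add_assoc]

/-- The integral against a `1/m`-invariant measure is determined by its pushforward under
multiplication by `m`. -/
lemma natCast_mul_lintegral_eq_of_map_add_inv_eq {m : ℕ} (hm : m ≠ 0)
    {ν : Measure (AddCircle (1 : ℝ))}
    (h : ν.map (· + (((m : ℝ)⁻¹ : ℝ) : AddCircle (1 : ℝ))) = ν)
    {f : AddCircle (1 : ℝ) → ENNReal} (hf : Measurable f) :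
    m * ∫⁻ x, f x ∂ν =
      ∫⁻ y, ∑ k ∈ Finset.range m, f (divNat m y + k • (((m : ℝ)⁻¹ : ℝ) : AddCircle (1 : ℝ)))
        ∂(ν.map (fun y => m • y)) := by
  set c := (((m : ℝ)⁻¹ : ℝ) : AddCircle (1 : ℝ))
  have hper : Function.Periodic (fun x => ∑ k ∈ Finset.range m, f (x + k • c)) c := fun x => by
    simpa [succ_nsmul', add_assoc] using
      Finset.sum_range_nsmul_succ (nsmul_coe_inv hm) (fun u => f (x + u))
  have hfiber (x : AddCircle (1 : ℝ)) :
      ∑ k ∈ Finset.range m, f (divNat m (m • x) + k • c) =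
        ∑ k ∈ Finset.range m, f (x + k • c) := by
    obtain ⟨z, hz⟩ := exists_zsmul_coe_inv_of_nsmul_eq_zero hm (u := divNat m (m • x) - x)
      (by rw [nsmul_sub, nsmul_divNat hm, sub_self])
    rw [sub_eq_iff_eq_add'] at hz
    rw [hz]
    exact hper.zsmul z x
  have hsm := measurable_divNat m
  rw [lintegral_map (by fun_prop) (by fun_prop)]
  simp_rw [hfiber]
  rw [lintegral_finsetSum _ (fun k _ => by fun_prop)]
  have hk (k : ℕ) : ∫⁻ x, f (x + k • c) ∂ν = ∫⁻ x, f x ∂ν := by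
    conv_rhs => rw [← map_add_nsmul_eq h k, lintegral_map hf (measurable_add_const _)]
  simp [hk]

lemma eq_of_map_nsmul_eq {m : ℕ} (hm : m ≠ 0) {ν ν' : Measure (AddCircle (1 : ℝ))}
    (h : ν.map (· + (((m : ℝ)⁻¹ : ℝ) : AddCircle (1 : ℝ))) = ν)
    (h' : ν'.map (· + (((m : ℝ)⁻¹ : ℝ) : AddCircle (1 : ℝ))) = ν')
    (heq : ν.map (fun y => m • y) = ν'.map (fun y => m • y)) : ν = ν' := by
  refine ext_of_lintegral _ fun f hf => ?_
  have key := natCast_mul_lintegral_eq_of_map_add_inv_eq hm h hf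
  rw [heq, ← natCast_mul_lintegral_eq_of_map_add_inv_eq hm h' hf] at key
  exact (ENNReal.mul_right_inj (Nat.cast_ne_zero.mpr hm) (ENNReal.natCast_ne_top m)).mp key

/-- The `1/m`-invariant measure on `ℝ/ℤ` whose pushforward under multiplication by `m` is `μ`. -/
noncomputable def nsmulLift (m : ℕ) (μ : Measure (AddCircle (1 : ℝ))) :
    Measure (AddCircle (1 : ℝ)) :=
  (m : ENNReal)⁻¹ • ∑ k ∈ Finset.range m,
    μ.map (fun y => divNat m y + k • (((m : ℝ)⁻¹ : ℝ) : AddCircle (1 : ℝ)))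

lemma map_add_nsmulLift {m : ℕ} (hm : m ≠ 0) (μ : Measure (AddCircle (1 : ℝ))) :
    (nsmulLift m μ).map (· + (((m : ℝ)⁻¹ : ℝ) : AddCircle (1 : ℝ))) = nsmulLift m μ := by
  have hsm := measurable_divNat m
  rw [nsmulLift, Measure.map_smul, map_finset_sum (measurable_add_const _).aemeasurable]
  congr 1
  rw [← Finset.sum_range_nsmul_succ (nsmul_coe_inv hm) (fun u => μ.map (fun y => divNat m y + u))]
  refine Finset.sum_congr rfl fun k _ => ?_
  rw [map_map (measurable_add_const _) (by fun_prop)]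
  congr 1
  ext y
  simp [succ_nsmul, add_assoc]

lemma map_nsmul_nsmulLift {m : ℕ} (hm : m ≠ 0) (μ : Measure (AddCircle (1 : ℝ))) :
    (nsmulLift m μ).map (fun y => m • y) = μ := by
  have hsm := measurable_divNat m
  rw [nsmulLift, Measure.map_smul, map_finset_sum (by fun_prop)]
  have hk (k : ℕ) : (μ.map (fun y => divNat m y +
      k • (((m : ℝ)⁻¹ : ℝ) : AddCircle (1 : ℝ)))).map (fun y => m • y) = μ := by
    rw [map_map (by fun_prop) (by fun_prop)]
    convert map_id
    ext y
    simp [nsmul_divNat hm, smul_comm m k, nsmul_coe_inv hm]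
  simp only [hk, Finset.sum_const, Finset.card_range]
  rw [← Nat.cast_smul_eq_nsmul ENNReal, smul_smul,
    ENNReal.inv_mul_cancel (Nat.cast_ne_zero.mpr hm) (ENNReal.natCast_ne_top m), one_smul]

lemma map_nsmul_nsmulLift_mul {m n : ℕ} (hm : m ≠ 0) (hn : n ≠ 0)
    (μ : Measure (AddCircle (1 : ℝ))) :
    (nsmulLift (n * m) μ).map (fun y => n • y) = nsmulLift m μ := by
  have hnm : n * m ≠ 0 := mul_ne_zero hn hm
  refine eq_of_map_nsmul_eq hm ?_ (map_add_nsmulLift hm μ) ?_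
  · conv_rhs => rw [← map_add_nsmulLift hnm μ]
    rw [map_map (measurable_add_const _) (by fun_prop),
      map_map (by fun_prop) (measurable_add_const _)]
    congr 1
    ext y
    have hn' : (n : ℝ) ≠ 0 := Nat.cast_ne_zero.mpr hn
    have : n • ((((n * m : ℕ) : ℝ)⁻¹ : ℝ) : AddCircle (1 : ℝ)) = (((m : ℝ)⁻¹ : ℝ)) := by
      rw [← coe_nsmul, nsmul_eq_mul, Nat.cast_mul, mul_inv, mul_inv_cancel_left₀ hn']
    simp only [Function.comp_apply, nsmul_add, this]
  · rw [map_map (by fun_prop) (by fun_prop), map_nsmul_nsmulLift hm]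
    conv_rhs => rw [← map_nsmul_nsmulLift hnm μ]
    congr 1
    ext y
    simp [mul_comm n m, mul_smul]

lemma isFiniteMeasure_nsmulLift {m : ℕ} (hm : m ≠ 0) (μ : Measure (AddCircle (1 : ℝ)))
    [IsFiniteMeasure μ] : IsFiniteMeasure (nsmulLift m μ) := by
  have h : IsFiniteMeasure ((nsmulLift m μ).map (fun y => m • y)) := by
    rw [map_nsmul_nsmulLift hm]
    infer_instance
  exact isFiniteMeasure_of_map (f := fun y => m • y) (by fun_prop)

end MeasureTheory.Measure

/-- For `β ∈ ℝ` and a finite Borel measure `λ₁` on `ℝ/ℤ` there is a unique family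
`(λ_m)_{m ∈ ℕ^×}` of finite Borel measures on `ℝ/ℤ` with `λ_1 = λ₁`, each `λ_m` invariant
under translation by `1/m`, and `λ_m = n^{β-1}·((y ↦ n·y)_* λ_{nm})` for all `m, n ∈ ℕ^×`. -/
theorem unique_family_of_measures (β : ℝ) (lam1 : Measure (AddCircle (1 : ℝ)))
    [IsFiniteMeasure lam1] :
    ∃! Lam : ℕ+ → Measure (AddCircle (1 : ℝ)),
      (∀ m : ℕ+, IsFiniteMeasure (Lam m)) ∧
      Lam 1 = lam1 ∧
      (∀ m : ℕ+, ∀ Y : Set (AddCircle (1 : ℝ)), MeasurableSet Y →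
        Lam m ((fun y => y + ((((m : ℕ) : ℝ)⁻¹ : ℝ) : AddCircle (1 : ℝ))) '' Y) = Lam m Y) ∧
      (∀ m n : ℕ+, Lam m =
        (((n : ℕ) : ENNReal) ^ (β - 1)) • (Lam (n * m)).map (fun y => (n : ℕ) • y)) := by
  have hm (m : ℕ+) : (m : ℕ) ≠ 0 := m.ne_zero
  have h0 (m : ℕ+) : ((m : ℕ) : ENNReal) ≠ 0 := Nat.cast_ne_zero.mpr (hm m)
  have ht (m : ℕ+) : ((m : ℕ) : ENNReal) ≠ ⊤ := ENNReal.natCast_ne_top _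
  have hcancel (m : ℕ+) :
      ((m : ℕ) : ENNReal) ^ (β - 1) * ((m : ℕ) : ENNReal) ^ (-(β - 1)) = 1 := by
    rw [← ENNReal.rpow_add _ _ (h0 m) (ht m), add_neg_cancel, ENNReal.rpow_zero]
  refine ⟨fun m => ((m : ℕ) : ENNReal) ^ (-(β - 1)) • Measure.nsmulLift m lam1,
    ⟨fun m => ?_, ?_, fun m => ?_, fun m n => ?_⟩, ?_⟩
  · have := Measure.isFiniteMeasure_nsmulLift (hm m) lam1
    exact Measure.smul_finite _ (ENNReal.rpow_ne_top_of_ne_zero (h0 m) (ht m))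
  · have h := Measure.map_nsmul_nsmulLift one_ne_zero lam1
    simp only [one_smul, Measure.map_id'] at h
    simp [h]
  · rw [Measure.forall_measure_image_add_right_iff, Measure.map_smul,
      Measure.map_add_nsmulLift (hm m)]
  · simp only [PNat.mul_coe]
    rw [Measure.map_smul, Measure.map_nsmul_nsmulLift_mul (hm m) (hm n), smul_smul, Nat.cast_mul,
      ENNReal.mul_rpow_of_ne_top (ht n) (ht m), ← mul_assoc, hcancel, one_mul]
  · rintro Lam ⟨-, h1, hinv, hcompat⟩
    ext1 m
    refine Measure.eq_of_map_nsmul_eq (hm m)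
      ((Measure.forall_measure_image_add_right_iff _ _).mp (hinv m)) ?_ ?_
    · rw [Measure.map_smul, Measure.map_add_nsmulLift (hm m)]
    · have h := hcompat 1 m
      rw [mul_one, h1] at h
      rw [Measure.map_smul, Measure.map_nsmul_nsmulLift (hm m), h, smul_smul, mul_comm, hcancel,
        one_smul]
end

section
/- If S ⊆ (0,∞) is a Lebesgue-measurable set such that q·S = S for every positive rational q, then either S has Lebesgue measure zero or (0,∞) \ S has Lebesgue measure zero. In other words, the multiplication action of ℚ₊^* on ((0,∞), Lebesgue measure) is ergodic. -/
open MeasureTheory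

open Pointwise in
/-- For a set invariant under positive rational scaling, the measure of its part below a positive
rational `q` is proportional to `q`. -/
lemma volume_inter_Iic_of_rat_mul_invariant (S : Set ℝ)
    (hinv : ∀ q : ℚ, 0 < q → (fun x => (q : ℝ) * x) '' S = S) {q : ℚ} (hq : 0 < q) :
    volume (Set.Iic (q : ℝ) ∩ S) = ENNReal.ofReal q * volume (Set.Iic (1 : ℝ) ∩ S) := by
  have hq' : (0 : ℝ) < q := by exact_mod_cast hq
  have hS : (q : ℝ) • S = S := hinv q hq
  have h : Set.Iic (q : ℝ) ∩ S = (q : ℝ) • (Set.Iic (1 : ℝ) ∩ S) := by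
    rw [Set.smul_set_inter₀ hq'.ne', hS, LinearOrderedField.smul_Iic hq', mul_one]
  rw [h, Measure.addHaar_smul]
  simp [abs_of_pos hq']

/-- A subset of `(0,∞)` invariant under positive rational scaling has constant
density in `(0,∞)`. -/
lemma volume_restrict_of_rat_mul_invariant (S : Set ℝ) (hS₀ : S ⊆ Set.Ioi (0 : ℝ))
    (hinv : ∀ q : ℚ, 0 < q → (fun x => (q : ℝ) * x) '' S = S) :
    volume.restrict S = volume (Set.Iic (1 : ℝ) ∩ S) • volume.restrict (Set.Ioi (0 : ℝ)) := by
  have hpos (t : ℝ) : volume (Set.Iic t ∩ Set.Ioi 0) = ENNReal.ofReal t := by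
    rw [Set.inter_comm, Set.Ioi_inter_Iic, Real.volume_Ioc, sub_zero]
  have hle (t : ℝ) : volume (Set.Iic t ∩ S) ≤ ENNReal.ofReal t :=
    hpos t ▸ measure_mono (Set.inter_subset_inter_right _ hS₀)
  refine Measure.ext_of_generateFrom_of_iUnion (⋃ a : ℚ, {Set.Iic (a : ℝ)})
    (fun n : ℕ => Set.Iic ((n : ℚ) : ℝ))
    (by rw [← Real.borel_eq_generateFrom_Iic_rat]; exact BorelSpace.measurable_eq)
    Real.isPiSystem_Iic_rat ?_ (fun n => by simpa using ⟨(n : ℚ), by simp⟩) ?_ ?_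
  · exact Set.iUnion_eq_univ_iff.2 fun x => (exists_nat_ge x).imp fun n hn => by simpa using hn
  · intro n
    rw [Measure.restrict_apply measurableSet_Iic]
    exact ((hle _).trans_lt ENNReal.ofReal_lt_top).ne
  · intro s hs
    obtain ⟨q, rfl⟩ := Set.mem_iUnion.1 hs
    rw [Measure.smul_apply, Measure.restrict_apply measurableSet_Iic,
      Measure.restrict_apply measurableSet_Iic, hpos, smul_eq_mul]
    rcases lt_or_ge 0 q with hq | hq
    · rw [volume_inter_Iic_of_rat_mul_invariant S hinv hq, mul_comm]
    · have h0 : ENNReal.ofReal (q : ℝ) = 0 := ENNReal.ofReal_of_nonpos (by exact_mod_cast hq)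
      rw [h0, mul_zero]
      exact le_antisymm (h0 ▸ hle q) zero_le

/-- If `S ⊆ (0,∞)` is Lebesgue-measurable and `q·S = S` for every positive rational `q`, then
`S` or `(0,∞) \ S` has Lebesgue measure zero: the multiplication action of `ℚ₊^*` on
`((0,∞), Lebesgue)` is ergodic. -/
theorem rat_mul_ergodic (S : Set ℝ) (hS₀ : S ⊆ Set.Ioi (0 : ℝ))
    (hS : NullMeasurableSet S (volume : Measure ℝ))
    (hinv : ∀ q : ℚ, 0 < q → (fun x => (q : ℝ) * x) '' S = S) :
    volume S = 0 ∨ volume (Set.Ioi (0 : ℝ) \ S) = 0 := by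
  have hdens (t : Set ℝ) :
      volume (t ∩ S) = volume (Set.Iic (1 : ℝ) ∩ S) * volume (t ∩ Set.Ioi 0) := by
    rw [← Measure.restrict_apply₀' hS, volume_restrict_of_rat_mul_invariant S hS₀ hinv,
      Measure.smul_apply, Measure.restrict_apply' measurableSet_Ioi, smul_eq_mul]
  by_cases hc : volume (Set.Iic (1 : ℝ) ∩ S) = 0
  · left
    simpa [hc] using hdens Set.univ
  · right
    have h := hdens (Set.Ioi 0 \ S)
    rw [Set.sdiff_inter_self, measure_empty, eq_comm, mul_eq_zero,
      Set.inter_eq_left.2 Set.sdiff_subset] at h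
    exact h.resolve_left hc
end
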